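/- arXiv:2106.01340 — 12 statements merged into one kernel-verified Lean document; each statement's English description precedes it below -/
import Mathlib

section
/- Let M (real transactions) and F (fake transactions) be disjoint finite sets, where each transaction t has a size s_t > 0. Let μ ≥ 0 be the miner's marginal cost per unit size and K > 0 the block capacity. Let p be a separable payment rule, assigning to each transaction t a per-unit-size payment p_t ∈ ℝ that does not depend on which other transactions are included, and let q be a burning rule assigning to each block B and each t ∈ B a per-unit-size burn q_t(B) ≥ 0. Let B* ⊆ M be a feasible subset maximizing Σ_{t∈B} (p_t − μ)·s_t over all feasible subsets B of M. Then for every finite set F of fake transactions and every feasible block B ⊆ M ∪ F, the myopic miner utility Σ_{t ∈ B∩M} p_t·s_t − Σ_{t ∈ B∩F} q_t(B)·s_t − μ·Σ_{t∈B} s_t is at most Σ_{t∈B*} (p_t − μ)·s_t, the utility obtained by creating no fake transactions and mining the block B*. In other words, any TFM with a separable payment rule, a nonnegative burning rule, and the corresponding revenue-maximizing allocation rule is incentive-compatible for myopic miners (MMIC). -/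
/-- Any TFM with a separable payment rule, a nonnegative burning rule,
and the corresponding revenue-maximizing allocation rule is MMIC: for every set of
fake transactions and every feasible block of real and fake transactions, the myopic
miner's utility is at most the utility of mining the revenue-maximizing block `Bstar`
with no fake transactions. -/
theorem separable_revenue_maximizing_implies_MMIC
    {ι : Type*} [DecidableEq ι]
    (M F : Finset ι) (hMF : Disjoint M F)
    (s : ι → ℝ) (hs : ∀ t, 0 < s t)
    (μ K : ℝ) (hμ : 0 ≤ μ) (hK : 0 < K)
    (p : ι → ℝ)
    (q : Finset ι → ι → ℝ) (hq : ∀ B t, t ∈ B → 0 ≤ q B t)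
    (Bstar : Finset ι) (hBsub : Bstar ⊆ M)
    (hBfeas : ∑ t ∈ Bstar, s t ≤ K)
    (hBopt : ∀ B ⊆ M, ∑ t ∈ B, s t ≤ K →
      ∑ t ∈ B, (p t - μ) * s t ≤ ∑ t ∈ Bstar, (p t - μ) * s t) :
    ∀ B ⊆ M ∪ F, ∑ t ∈ B, s t ≤ K →
      (∑ t ∈ B ∩ M, p t * s t) - (∑ t ∈ B ∩ F, q B t * s t)
          - μ * ∑ t ∈ B, s t
        ≤ ∑ t ∈ Bstar, (p t - μ) * s t := by
  intro B _ hBK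
  have hle : ∑ t ∈ B ∩ M, s t ≤ ∑ t ∈ B, s t :=
    Finset.sum_le_sum_of_subset_of_nonneg Finset.inter_subset_left
      (fun t _ _ => (hs t).le)
  have h1 := hBopt (B ∩ M) Finset.inter_subset_right (hle.trans hBK)
  have h2 : 0 ≤ ∑ t ∈ B ∩ F, q B t * s t :=
    Finset.sum_nonneg (fun t ht =>
      mul_nonneg (hq B t (Finset.mem_inter.mp ht).1) (hs t).le)
  have h3 := mul_le_mul_of_nonneg_left hle hμ
  have h4 : ∑ t ∈ B ∩ M, (p t - μ) * s t
      = ∑ t ∈ B ∩ M, p t * s t - μ * ∑ t ∈ B ∩ M, s t := by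
    rw [Finset.mul_sum, ← Finset.sum_sub_distrib]
    exact Finset.sum_congr rfl (fun t _ => by ring)
  linarith
end

section
/- In the first-price auction (FPA), each transaction t carries a bid b_t ≥ 0 per unit size, an included transaction pays its bid to the miner (p_t = b_t) and nothing is burned (q_t = 0); the intended allocation rule chooses a feasible block B* ⊆ M maximizing Σ_{t∈B} (b_t − μ)·s_t. Then the FPA is MMIC: for every finite set F of fake transactions (each with an arbitrary size and bid) and every feasible block B ⊆ M ∪ F, the miner's utility Σ_{t∈B∩M} b_t·s_t − μ·Σ_{t∈B} s_t is at most Σ_{t∈B*} (b_t − μ)·s_t. -/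
/-- The first-price auction is MMIC: for every set `F` of fake
transactions and every feasible block `B ⊆ M ∪ F`, the miner's utility
(revenue from real included transactions minus marginal costs) is at most
the utility from honestly mining the intended block `Bstar`, a feasible
subset of the mempool `M` maximizing `∑ (b t - μ) * s t`. -/
theorem fpa_mmic
    {ι : Type*} [DecidableEq ι]
    (M F : Finset ι) (hMF : Disjoint M F)
    (s b : ι → ℝ) (hs : ∀ t, 0 < s t) (hb : ∀ t, 0 ≤ b t)
    (μ K : ℝ) (hμ : 0 ≤ μ) (hK : 0 < K)
    (Bstar : Finset ι) (hBsub : Bstar ⊆ M)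
    (hBfeas : ∑ t ∈ Bstar, s t ≤ K)
    (hBopt : ∀ B ⊆ M, ∑ t ∈ B, s t ≤ K →
      ∑ t ∈ B, (b t - μ) * s t ≤ ∑ t ∈ Bstar, (b t - μ) * s t) :
    ∀ B ⊆ M ∪ F, ∑ t ∈ B, s t ≤ K →
      (∑ t ∈ B ∩ M, b t * s t) - μ * ∑ t ∈ B, s t
        ≤ ∑ t ∈ Bstar, (b t - μ) * s t := by
  intro B _ hf
  have h1 : ∑ t ∈ B ∩ M, s t ≤ ∑ t ∈ B, s t :=
    Finset.sum_le_sum_of_subset_of_nonneg Finset.inter_subset_left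
      (fun t _ _ => (hs t).le)
  have h2 := hBopt (B ∩ M) Finset.inter_subset_right (h1.trans hf)
  have h3 : ∑ t ∈ B ∩ M, (b t - μ) * s t
      = (∑ t ∈ B ∩ M, b t * s t) - μ * ∑ t ∈ B ∩ M, s t := by
    simp only [sub_mul, Finset.sum_sub_distrib, Finset.mul_sum]
  have h4 := mul_le_mul_of_nonneg_left h1 hμ
  linarith
end

section
/- In the 1559 mechanism with base fee r ≥ 0, only transactions with bid b_t ≥ r are eligible for inclusion; an included transaction pays b_t − r per unit size to the miner and burns r per unit size; the intended allocation rule chooses a feasible block B* of eligible transactions in M maximizing Σ_{t∈B} (b_t − r − μ)·s_t. Then the 1559 mechanism is MMIC: for every finite set F of fake transactions and every feasible block B ⊆ M ∪ F of eligible transactions, the miner's utility Σ_{t∈B∩M} (b_t − r)·s_t − Σ_{t∈B∩F} r·s_t − μ·Σ_{t∈B} s_t is at most Σ_{t∈B*} (b_t − r − μ)·s_t. -/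
/-- The 1559 mechanism with base fee `r` is MMIC: for every set `F`
of fake transactions and every feasible block `B ⊆ M ∪ F` of eligible transactions
(bid at least `r`), the miner's utility (tips from real included transactions, minus
the burn on its own fake included transactions, minus marginal costs) is at most the
utility from honestly mining the intended block `Bstar`, a feasible block of eligible
transactions of `M` maximizing `∑ (b t - r - μ) * s t`. -/
theorem mech1559_mmic
    {ι : Type*} [DecidableEq ι]
    (M F : Finset ι) (hMF : Disjoint M F)
    (s b : ι → ℝ) (hs : ∀ t, 0 < s t) (hb : ∀ t, 0 ≤ b t)
    (r μ K : ℝ) (hr : 0 ≤ r) (hμ : 0 ≤ μ) (hK : 0 < K)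
    (Bstar : Finset ι) (hBsub : Bstar ⊆ M)
    (hBelig : ∀ t ∈ Bstar, r ≤ b t)
    (hBfeas : ∑ t ∈ Bstar, s t ≤ K)
    (hBopt : ∀ B ⊆ M, (∀ t ∈ B, r ≤ b t) → ∑ t ∈ B, s t ≤ K →
      ∑ t ∈ B, (b t - r - μ) * s t ≤ ∑ t ∈ Bstar, (b t - r - μ) * s t) :
    ∀ B ⊆ M ∪ F, (∀ t ∈ B, r ≤ b t) → ∑ t ∈ B, s t ≤ K →
      (∑ t ∈ B ∩ M, (b t - r) * s t) - (∑ t ∈ B ∩ F, r * s t)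
          - μ * ∑ t ∈ B, s t
        ≤ ∑ t ∈ Bstar, (b t - r - μ) * s t := by
  intro B _ hel hfe
  have h1 : ∑ t ∈ B ∩ M, s t ≤ ∑ t ∈ B, s t :=
    Finset.sum_le_sum_of_subset_of_nonneg Finset.inter_subset_left
      (fun t _ _ => (hs t).le)
  have h2 := hBopt (B ∩ M) Finset.inter_subset_right
    (fun t ht => hel t (Finset.mem_inter.1 ht).1) (h1.trans hfe)
  have h3 : 0 ≤ ∑ t ∈ B ∩ F, r * s t :=
    Finset.sum_nonneg (fun t _ => mul_nonneg hr (hs t).le)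
  have h4 : ∑ t ∈ B ∩ M, (b t - r - μ) * s t
      = ∑ t ∈ B ∩ M, (b t - r) * s t - μ * ∑ t ∈ B ∩ M, s t := by
    rw [Finset.mul_sum, ← Finset.sum_sub_distrib]
    exact Finset.sum_congr rfl (fun t _ => by ring)
  have h5 := mul_le_mul_of_nonneg_left h1 hμ
  linarith
end

section
/- In the tipless mechanism with base fee r ≥ 0 and hard-coded tip δ ≥ 0, only transactions with bid b_t ≥ r + δ are eligible for inclusion; an included transaction pays δ per unit size to the miner and burns r per unit size; the intended allocation rule chooses a feasible block B* of eligible transactions in M maximizing (δ − μ)·Σ_{t∈B} s_t. Then the tipless mechanism is MMIC: for every finite set F of fake transactions and every feasible block B ⊆ M ∪ F of eligible transactions, the miner's utility δ·Σ_{t∈B∩M} s_t − r·Σ_{t∈B∩F} s_t − μ·Σ_{t∈B} s_t is at most (δ − μ)·Σ_{t∈B*} s_t. -/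
/-- The tipless mechanism with base fee `r` and hard-coded tip `δ`
is MMIC: for every set `F` of fake transactions and every feasible block
`B ⊆ M ∪ F` of eligible transactions (bid at least `r + δ`), the miner's utility
(`δ` per unit size on real included transactions, minus the burn `r` per unit size
on its own fake included transactions, minus marginal costs) is at most the utility
from honestly mining the intended block `Bstar`, a feasible block of eligible
transactions of `M` maximizing `(δ - μ) * ∑ s t`. -/
theorem tipless_mmic
    {ι : Type*} [DecidableEq ι]
    (M F : Finset ι) (hMF : Disjoint M F)
    (s b : ι → ℝ) (hs : ∀ t, 0 < s t) (hb : ∀ t, 0 ≤ b t)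
    (r δ μ K : ℝ) (hr : 0 ≤ r) (hδ : 0 ≤ δ) (hμ : 0 ≤ μ) (hK : 0 < K)
    (Bstar : Finset ι) (hBsub : Bstar ⊆ M)
    (hBelig : ∀ t ∈ Bstar, r + δ ≤ b t)
    (hBfeas : ∑ t ∈ Bstar, s t ≤ K)
    (hBopt : ∀ B ⊆ M, (∀ t ∈ B, r + δ ≤ b t) → ∑ t ∈ B, s t ≤ K →
      (δ - μ) * ∑ t ∈ B, s t ≤ (δ - μ) * ∑ t ∈ Bstar, s t) :
    ∀ B ⊆ M ∪ F, (∀ t ∈ B, r + δ ≤ b t) → ∑ t ∈ B, s t ≤ K →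
      δ * (∑ t ∈ B ∩ M, s t) - r * (∑ t ∈ B ∩ F, s t)
          - μ * ∑ t ∈ B, s t
        ≤ (δ - μ) * ∑ t ∈ Bstar, s t := by
  intro B _ hel hfe
  have h1 : ∑ t ∈ B ∩ M, s t ≤ ∑ t ∈ B, s t :=
    Finset.sum_le_sum_of_subset_of_nonneg Finset.inter_subset_left
      (fun t _ _ => (hs t).le)
  have h2 : 0 ≤ ∑ t ∈ B ∩ F, s t := Finset.sum_nonneg (fun t _ => (hs t).le)
  have h3 := hBopt (B ∩ M) Finset.inter_subset_right
    (fun t ht => hel t (Finset.mem_inter.mp ht).1) (h1.trans hfe)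
  have h4 := mul_le_mul_of_nonneg_left h1 hμ
  have h5 := mul_nonneg hr h2
  linarith
end

section
/- The tipless mechanism is DSIC. Fix a base fee r ≥ 0, a hard-coded tip δ ≥ 0, and an allocation rule x mapping each bid profile on a finite set T of transactions to a feasible block such that (i) every included transaction has bid at least r + δ, and (ii) the chosen block depends only on the set of eligible transactions {t : b_t ≥ r + δ} (tie-breaking is consistent and independent of the bids themselves). An included transaction t yields utility (v_t − δ − r)·s_t to its creator, and an excluded transaction yields utility 0. Then for every transaction t with valuation v_t, the bid b_t = min{r + δ, v_t} is a dominant strategy: for every profile of bids of the other transactions and every alternative bid b̂_t, the utility of t's creator under b_t = min{r + δ, v_t} is at least its utility under b̂_t. -/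
/-- The tipless mechanism is DSIC.  For any allocation rule `x` that
only includes eligible transactions (bid at least `r + δ`), is feasible, and depends
on the bids only through the set of eligible transactions, the bid
`min (r + δ) (v t)` is a dominant strategy for the creator of transaction `t`:
against any bids `b` of the others and any alternative bid `bhat`, the creator's
utility (which is `(v t - δ - r) * s t` if included and `0` if excluded) under the
bid `min (r + δ) (v t)` is at least the utility under `bhat`. -/
theorem tipless_dsic
    {ι : Type*} [DecidableEq ι]
    (T : Finset ι) (s v : ι → ℝ) (hs : ∀ t, 0 < s t) (hv : ∀ t, 0 ≤ v t)
    (r δ K : ℝ) (hr : 0 ≤ r) (hδ : 0 ≤ δ) (hK : 0 < K)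
    (x : (ι → ℝ) → Finset ι)
    (hx_sub : ∀ b, x b ⊆ T)
    (hx_feas : ∀ b, ∑ w ∈ x b, s w ≤ K)
    (hx_elig : ∀ b, ∀ w ∈ x b, r + δ ≤ b w)
    (hx_consist : ∀ b b' : ι → ℝ,
      (∀ w ∈ T, (r + δ ≤ b w ↔ r + δ ≤ b' w)) → x b = x b')
    (t : ι) (ht : t ∈ T)
    (b : ι → ℝ) (hb : ∀ w, 0 ≤ b w)
    (bhat : ℝ) (hbhat : 0 ≤ bhat) :
    (if t ∈ x (Function.update b t bhat) then (v t - δ - r) * s t else 0)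
      ≤ (if t ∈ x (Function.update b t (min (r + δ) (v t)))
          then (v t - δ - r) * s t else 0) := by
  have hst := hs t
  rcases lt_or_ge (v t) (r + δ) with h | h
  · have hn : t ∉ x (Function.update b t (min (r + δ) (v t))) := by
      intro hm
      have h1 := hx_elig _ t hm
      rw [Function.update_self] at h1
      have h2 := min_le_right (r + δ) (v t)
      linarith
    rw [if_neg hn]
    split_ifs
    · exact mul_nonpos_of_nonpos_of_nonneg (by linarith) hst.le
    · exact le_refl _
  · have hnn : 0 ≤ (v t - δ - r) * s t := mul_nonneg (by linarith) hst.le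
    by_cases hm : t ∈ x (Function.update b t bhat)
    · have h1 := hx_elig _ t hm
      rw [Function.update_self] at h1
      have he : x (Function.update b t bhat)
          = x (Function.update b t (min (r + δ) (v t))) := by
        apply hx_consist
        intro w _
        by_cases hw : w = t
        · subst hw
          rw [Function.update_self, Function.update_self, min_eq_left h]
          exact ⟨fun _ => le_refl _, fun _ => h1⟩
        · rw [Function.update_of_ne hw, Function.update_of_ne hw]
      rw [he]
    · rw [if_neg hm]
      split_ifs
      · exact hnn
      · exact le_refl _
end

section
/- The 1559 mechanism is DSIC when the base fee is not excessively low and users do not overbid. Fix a base fee r ≥ 0, marginal cost μ ≥ 0, maximum block size 2C, and a finite set T of transactions with sizes s_t > 0 and valuations v_t ≥ 0 such that Σ_{t : v_t ≥ r+μ} s_t ≤ 2C (the base fee is not excessively low). Suppose the allocation rule includes only transactions with bid at least r + μ, and includes all transactions with bid at least r + μ whenever their total size is at most 2C. An included transaction t with bid b_t yields utility (v_t − b_t)·s_t to its creator (it pays b_t − r to the miner and burns r, per unit size), and an excluded transaction yields utility 0. If every transaction w ≠ t bids b_w ≤ v_w (no overbidding), then the bid b_t = min{r + μ, v_t} maximizes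 the utility of t's creator over all possible bids b̂_t. -/
/-- The 1559 mechanism is DSIC when the base fee is not excessively
low and other users do not overbid.  With base fee `r`, marginal cost `μ`, maximum
block size `2C`, a demand condition `∑_{t : v t ≥ r + μ} s t ≤ 2C`, and an
allocation rule that includes only transactions bidding at least `r + μ` and
includes all of them whenever their total size fits, the bid `min (r + μ) (v t)`
maximizes the utility of `t`'s creator (an included transaction with bid `β` yields
utility `(v t - β) * s t`; an excluded one yields `0`) over every alternative bid
`bhat`, provided every other transaction `w` bids at most `v w`. -/
theorem mech1559_dsic
    {ι : Type*} [DecidableEq ι]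
    (r μ C : ℝ) (hr : 0 ≤ r) (hμ : 0 ≤ μ) (hC : 0 < C)
    (T : Finset ι) (s v : ι → ℝ) (hs : ∀ t, 0 < s t) (hv : ∀ t, 0 ≤ v t)
    (hnotlow : ∑ w ∈ T.filter (fun w => r + μ ≤ v w), s w ≤ 2 * C)
    (x : (ι → ℝ) → Finset ι)
    (hx_sub : ∀ b, x b ⊆ T)
    (hx_feas : ∀ b, ∑ w ∈ x b, s w ≤ 2 * C)
    (hx_elig : ∀ b, ∀ w ∈ x b, r + μ ≤ b w)
    (hx_full : ∀ b : ι → ℝ,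
      ∑ w ∈ T.filter (fun w => r + μ ≤ b w), s w ≤ 2 * C →
      T.filter (fun w => r + μ ≤ b w) ⊆ x b)
    (t : ι) (ht : t ∈ T)
    (b : ι → ℝ) (hb : ∀ w, 0 ≤ b w)
    (hnoover : ∀ w ∈ T, w ≠ t → b w ≤ v w)
    (bhat : ℝ) (hbhat : 0 ≤ bhat) :
    (if t ∈ x (Function.update b t bhat) then (v t - bhat) * s t else 0)
      ≤ (if t ∈ x (Function.update b t (min (r + μ) (v t)))
          then (v t - min (r + μ) (v t)) * s t else 0) := by
  have hst := hs t
  have hL : t ∈ x (Function.update b t bhat) → r + μ ≤ bhat := by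
    intro h
    have := hx_elig _ t h
    simpa using this
  by_cases hvt : r + μ ≤ v t
  · rw [min_eq_left hvt]
    have hsub : T.filter (fun w => r + μ ≤ Function.update b t (r + μ) w) ⊆
        T.filter (fun w => r + μ ≤ v w) := by
      intro w hw
      rw [Finset.mem_filter] at hw ⊢
      refine ⟨hw.1, ?_⟩
      by_cases hwt : w = t
      · rw [hwt]; exact hvt
      · have h2 := hw.2
        rw [Function.update_of_ne hwt] at h2
        exact h2.trans (hnoover w hw.1 hwt)
    have hsum := (Finset.sum_le_sum_of_subset_of_nonneg hsub
      (fun i _ _ => (hs i).le)).trans hnotlow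
    have hmem : t ∈ x (Function.update b t (r + μ)) :=
      hx_full _ hsum (by simp [ht])
    rw [if_pos hmem]
    split_ifs with h
    · have := hL h
      exact mul_le_mul_of_nonneg_right (by linarith) hst.le
    · exact mul_nonneg (by linarith) hst.le
  · push Not at hvt
    rw [min_eq_right hvt.le]
    have h0 : (if t ∈ x (Function.update b t (v t)) then (v t - v t) * s t else 0) = 0 := by
      simp
    rw [h0]
    split_ifs with h
    · have := hL h
      exact mul_nonpos_of_nonpos_of_nonneg (by linarith) hst.le
    · exact le_rfl
end

section
/- The β-burn 1559 mechanism is DSIC under the same conditions as the 1559 mechanism. Fix β ∈ [0,1), a base fee r ≥ 0, marginal cost μ ≥ 0, maximum block size 2C, and a finite set T of transactions with sizes s_t > 0 and valuations v_t ≥ 0 such that Σ_{t : v_t ≥ r+μ} s_t ≤ 2C. Suppose the allocation rule includes only transactions with bid at least r + μ, and includes all transactions with bid at least r + μ whenever their total size is at most 2C. An included transaction t pays b_t − βr per unit size to the miner and burns βr per unit size, so its creator's utility is (v_t − b_t)·s_t, and an excluded transaction yields utility 0. If every transaction w ≠ t bids b_w ≤ v_w, then the bid b_t = min{r + μ, v_t}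 maximizes the utility of t's creator over all possible bids b̂_t. -/
/-- The β-burn 1559 mechanism (with `β ∈ [0,1)`) is DSIC under the
same conditions as the 1559 mechanism: the user-facing total per-unit-size charge
of an included transaction is its bid (split as `b t - β·r` to the miner and `β·r`
burned), so with a base fee that is not excessively low and no overbidding by the
other users, the bid `min (r + μ) (v t)` maximizes the utility of `t`'s creator
over every alternative bid `bhat`. -/
theorem beta_burn_1559_dsic
    {ι : Type*} [DecidableEq ι]
    (β r μ C : ℝ) (hβ0 : 0 ≤ β) (hβ1 : β < 1)
    (hr : 0 ≤ r) (hμ : 0 ≤ μ) (hC : 0 < C)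
    (T : Finset ι) (s v : ι → ℝ) (hs : ∀ t, 0 < s t) (hv : ∀ t, 0 ≤ v t)
    (hnotlow : ∑ w ∈ T.filter (fun w => r + μ ≤ v w), s w ≤ 2 * C)
    (x : (ι → ℝ) → Finset ι)
    (hx_sub : ∀ b, x b ⊆ T)
    (hx_feas : ∀ b, ∑ w ∈ x b, s w ≤ 2 * C)
    (hx_elig : ∀ b, ∀ w ∈ x b, r + μ ≤ b w)
    (hx_full : ∀ b : ι → ℝ,
      ∑ w ∈ T.filter (fun w => r + μ ≤ b w), s w ≤ 2 * C →
      T.filter (fun w => r + μ ≤ b w) ⊆ x b)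
    (t : ι) (ht : t ∈ T)
    (b : ι → ℝ) (hb : ∀ w, 0 ≤ b w)
    (hnoover : ∀ w ∈ T, w ≠ t → b w ≤ v w)
    (bhat : ℝ) (hbhat : 0 ≤ bhat) :
    (if t ∈ x (Function.update b t bhat) then (v t - bhat) * s t else 0)
      ≤ (if t ∈ x (Function.update b t (min (r + μ) (v t)))
          then (v t - min (r + μ) (v t)) * s t else 0) := by
  have hL : t ∈ x (Function.update b t bhat) → r + μ ≤ bhat := by
    intro h
    have h2 := hx_elig _ t h
    rwa [Function.update_self] at h2
  have hst := hs t
  by_cases hvt : r + μ ≤ v t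
  · have hmin : min (r + μ) (v t) = r + μ := min_eq_left hvt
    rw [hmin]
    have hin : t ∈ x (Function.update b t (r + μ)) := by
      apply hx_full
      · refine le_trans (Finset.sum_le_sum_of_subset_of_nonneg ?_ ?_) hnotlow
        · intro w hw
          rw [Finset.mem_filter] at hw ⊢
          refine ⟨hw.1, ?_⟩
          by_cases hwt : w = t
          · rw [hwt]; exact hvt
          · have h2 := hw.2
            rw [Function.update_of_ne hwt] at h2
            exact h2.trans (hnoover w hw.1 hwt)
        · intro w _ _
          exact (hs w).le
      · rw [Finset.mem_filter, Function.update_self]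
        exact ⟨ht, le_rfl⟩
    rw [if_pos hin]
    split_ifs with h
    · have := hL h
      exact mul_le_mul_of_nonneg_right (by linarith) hst.le
    · exact mul_nonneg (by linarith) hst.le
  · have hlt : v t < r + μ := not_le.mp hvt
    rw [min_eq_right hlt.le, sub_self, zero_mul, ite_self]
    split_ifs with h
    · have := hL h
      exact mul_nonpos_of_nonpos_of_nonneg (by linarith) hst.le
    · exact le_rfl
end

section
/- A transaction fee mechanism is OCA-proof if and only if there always exists an individually rational bidding strategy leading to a joint-utility-maximizing outcome. Precisely: fix a universe of transactions with sizes s_t > 0, a capacity K > 0, a marginal cost μ ≥ 0, and a TFM given by an allocation rule x mapping each finite set T of transactions with a bid vector b to a feasible block x(b) ⊆ T, a payment rule p and a burning rule q assigning to each included transaction t ∈ x(b) per-unit-size amounts p_t(b) ∈ ℝ and q_t(b) ≥ 0. A bidding strategy σ : ℝ≥0 → ℝ≥0 is individually rational if for every T, every valuation vector v, and every t ∈ x(σ(v)), p_t(σ(v)) + q_t(σ(v)) ≤ v_t. The joint utility of the outcome with bids b is Σ_{t ∈ x(b)} (v_t − q_t(b) − μ)·s_t. An off-chain agreement (OCA)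 for (T, v) specifies a bid vector b (with the miner mining the block x(b)) and per-unit-size off-chain transfers τ_t from each creator to the miner; under it, the creator of t receives utility ((v_t − p_t(b) − q_t(b))·[t ∈ x(b)] − τ_t)·s_t and the miner receives Σ_{t∈x(b)} (p_t(b) − μ)·s_t + Σ_{t∈T} τ_t·s_t. Then: there exists an individually rational bidding strategy σ such that for every T and v, no OCA gives strictly higher utility to every creator in T and to the miner than the outcome with bids σ(v) and zero transfers, IF AND ONLY IF there exists an individually rational bidding strategy σ such that for every T and v, the joint utility of the outcome with bids σ(v) is at least the joint utility of the outcome with bids b, for every bid vector b. -/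
theorem joint_split_aux {ι : Type*} [DecidableEq ι] (s v p q : ι → ℝ) (μ : ℝ)
    (A T : Finset ι) (h : A ⊆ T) :
    ∑ t ∈ T, (if t ∈ A then (v t - p t - q t) else 0) * s t + ∑ t ∈ A, (p t - μ) * s t
      = ∑ t ∈ A, (v t - q t - μ) * s t := by
  have h1 : ∑ t ∈ T, (if t ∈ A then (v t - p t - q t) else 0) * s t
      = ∑ t ∈ A, (v t - p t - q t) * s t := by
    rw [← Finset.sum_subset h]
    · exact Finset.sum_congr rfl (fun t ht => by rw [if_pos ht])
    · intro t _ ht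
      rw [if_neg ht, zero_mul]
  rw [h1, ← Finset.sum_add_distrib]
  exact Finset.sum_congr rfl (fun t _ => by ring)

/-- A TFM is OCA-proof if and only if there always exists an
individually rational bidding strategy leading to a joint-utility-maximizing
outcome.  Left-hand side: there is an individually rational bidding strategy `σ`
such that for every mempool `T` and valuations `v`, no off-chain agreement
(a bid vector `b` together with per-unit-size transfers `τ`) gives strictly higher
utility to every transaction creator in `T` and to the miner than the on-chain
outcome with bids `σ ∘ v` and zero transfers.  Right-hand side: there is an
individually rational bidding strategy `σ` such that for every `T`, `v` and every
bid vector `b`, the joint utility `∑_{t ∈ x T b} (v t - q T b t - μ) * s t` of the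
outcome on bids `b` is at most that of the outcome on bids `σ ∘ v`. -/
theorem oca_proof_iff_joint_utility_maximization
    {ι : Type*} [DecidableEq ι]
    (s : ι → ℝ) (hs : ∀ t, 0 < s t)
    (μ K : ℝ) (hμ : 0 ≤ μ) (hK : 0 < K)
    (x : Finset ι → (ι → ℝ) → Finset ι)
    (hx_sub : ∀ T b, x T b ⊆ T)
    (hx_feas : ∀ T b, ∑ t ∈ x T b, s t ≤ K)
    (p q : Finset ι → (ι → ℝ) → ι → ℝ)
    (hq : ∀ T b t, t ∈ x T b → 0 ≤ q T b t) :
    (∃ σ : ℝ → ℝ, (∀ w, 0 ≤ w → 0 ≤ σ w) ∧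
      (∀ (T : Finset ι) (v : ι → ℝ), (∀ t, 0 ≤ v t) →
        ∀ t ∈ x T (σ ∘ v), p T (σ ∘ v) t + q T (σ ∘ v) t ≤ v t) ∧
      (∀ (T : Finset ι) (v : ι → ℝ), (∀ t, 0 ≤ v t) →
        ¬ ∃ (b τ : ι → ℝ), (∀ t, 0 ≤ b t) ∧
          (∀ t ∈ T,
            (if t ∈ x T (σ ∘ v)
              then (v t - p T (σ ∘ v) t - q T (σ ∘ v) t) else 0) * s t
            < ((if t ∈ x T b then (v t - p T b t - q T b t) else 0) - τ t) * s t) ∧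
          (∑ t ∈ x T (σ ∘ v), (p T (σ ∘ v) t - μ) * s t
            < ∑ t ∈ x T b, (p T b t - μ) * s t + ∑ t ∈ T, τ t * s t)))
    ↔
    (∃ σ : ℝ → ℝ, (∀ w, 0 ≤ w → 0 ≤ σ w) ∧
      (∀ (T : Finset ι) (v : ι → ℝ), (∀ t, 0 ≤ v t) →
        ∀ t ∈ x T (σ ∘ v), p T (σ ∘ v) t + q T (σ ∘ v) t ≤ v t) ∧
      (∀ (T : Finset ι) (v : ι → ℝ), (∀ t, 0 ≤ v t) →
        ∀ b : ι → ℝ, (∀ t, 0 ≤ b t) →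
          ∑ t ∈ x T b, (v t - q T b t - μ) * s t
            ≤ ∑ t ∈ x T (σ ∘ v), (v t - q T (σ ∘ v) t - μ) * s t)) := by
  refine exists_congr fun σ => and_congr_right fun _ => and_congr_right fun _ =>
    forall_congr' fun T => forall_congr' fun v => forall_congr' fun _ => ?_
  have hσ := joint_split_aux s v (p T (σ ∘ v)) (q T (σ ∘ v)) μ _ T (hx_sub T (σ ∘ v))
  constructor
  · intro h b hb
    by_contra hlt
    push Not at hlt
    apply h
    have hB := joint_split_aux s v (p T b) (q T b) μ _ T (hx_sub T b)
    have hS : 0 ≤ ∑ t ∈ T, s t := Finset.sum_nonneg fun t _ => (hs t).le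
    obtain ⟨ε, hε, hεS⟩ : ∃ ε : ℝ, 0 < ε ∧ ε * ∑ t ∈ T, s t <
        ∑ t ∈ x T b, (v t - q T b t - μ) * s t
          - ∑ t ∈ x T (σ ∘ v), (v t - q T (σ ∘ v) t - μ) * s t := by
      have hd := sub_pos.2 hlt
      refine ⟨_ / (∑ t ∈ T, s t + 1), div_pos hd (by linarith), ?_⟩
      rw [div_mul_eq_mul_div, div_lt_iff₀ (by linarith)]
      nlinarith
    refine ⟨b, fun t => (if t ∈ x T b then (v t - p T b t - q T b t) else 0)
      - (if t ∈ x T (σ ∘ v) then (v t - p T (σ ∘ v) t - q T (σ ∘ v) t) else 0) - ε,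
      hb, ?_, ?_⟩
    · intro t _
      apply mul_lt_mul_of_pos_right _ (hs t)
      linarith
    · simp only [sub_mul _ _ (s _), Finset.sum_sub_distrib, ← Finset.mul_sum] at hσ hB hεS ⊢
      linarith
  · rintro h ⟨b, τ, hb, hc, hm⟩
    have hB := joint_split_aux s v (p T b) (q T b) μ _ T (hx_sub T b)
    have h1 := h b hb
    have h2 := Finset.sum_le_sum fun t ht => (hc t ht).le
    have h3 : ∀ f : ι → ℝ, ∑ t ∈ T, (f t - τ t) * s t
        = ∑ t ∈ T, f t * s t - ∑ t ∈ T, τ t * s t := fun f => by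
      simp only [sub_mul, Finset.sum_sub_distrib]
    rw [h3] at h2
    linarith
end

section
/- The first-price auction is OCA-proof: fix marginal cost μ ≥ 0, capacity K > 0, and any γ ∈ (0,1]. The bidding strategy σ(v) = min{v, μ + γ(v − μ)} is individually rational for the FPA (where an included transaction pays its bid and nothing is burned), and for every finite set T of transactions with sizes s_t > 0 and valuations v_t ≥ 0, every feasible block B* ⊆ T maximizing Σ_{t∈B} (σ(v_t) − μ)·s_t over feasible blocks B ⊆ T also maximizes the joint utility Σ_{t∈B} (v_t − μ)·s_t over all feasible blocks B ⊆ T. Hence no off-chain agreement can make every transaction creator and the miner strictly better off than the on-chain outcome under bids σ(v). -/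
/-- The first-price auction is OCA-proof.  For any `γ ∈ (0,1]`, the
bidding strategy `σ(w) = min w (μ + γ·(w - μ))` is individually rational (the bid,
which is the total charge in an FPA, never exceeds the valuation), and every
feasible block `Bstar` maximizing `∑ (σ(v t) - μ) * s t` over feasible blocks of `T`
also maximizes the joint utility `∑ (v t - μ) * s t` over all feasible blocks of `T`. -/
theorem fpa_oca_proof
    {ι : Type*} (μ K γ : ℝ) (hμ : 0 ≤ μ) (hK : 0 < K)
    (hγ0 : 0 < γ) (hγ1 : γ ≤ 1) :
    (∀ w : ℝ, 0 ≤ w → min w (μ + γ * (w - μ)) ≤ w) ∧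
    (∀ (T : Finset ι) (s v : ι → ℝ), (∀ t, 0 < s t) → (∀ t, 0 ≤ v t) →
      ∀ Bstar ⊆ T, ∑ t ∈ Bstar, s t ≤ K →
        (∀ B ⊆ T, ∑ t ∈ B, s t ≤ K →
          ∑ t ∈ B, (min (v t) (μ + γ * (v t - μ)) - μ) * s t
            ≤ ∑ t ∈ Bstar, (min (v t) (μ + γ * (v t - μ)) - μ) * s t) →
        ∀ B ⊆ T, ∑ t ∈ B, s t ≤ K →
          ∑ t ∈ B, (v t - μ) * s t ≤ ∑ t ∈ Bstar, (v t - μ) * s t) := by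
  classical
  refine ⟨fun w _ => min_le_left _ _, ?_⟩
  intro T s v hs hv Bstar hBs hfeas hmax B hB hBK
  have hsub : B.filter (fun t => μ ≤ v t) ⊆ B := Finset.filter_subset _ _
  have h1 := hmax (B.filter (fun t => μ ≤ v t)) (hsub.trans hB)
    ((Finset.sum_le_sum_of_subset_of_nonneg hsub (fun t _ _ => (hs t).le)).trans hBK)
  have h2 : ∑ t ∈ Bstar, (min (v t) (μ + γ * (v t - μ)) - μ) * s t
      ≤ γ * ∑ t ∈ Bstar, (v t - μ) * s t := by
    rw [Finset.mul_sum]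
    refine Finset.sum_le_sum fun t _ => ?_
    rw [← mul_assoc]
    refine mul_le_mul_of_nonneg_right ?_ (hs t).le
    linarith [min_le_right (v t) (μ + γ * (v t - μ))]
  have h3 : γ * ∑ t ∈ B, (v t - μ) * s t
      ≤ ∑ t ∈ B.filter (fun t => μ ≤ v t), (min (v t) (μ + γ * (v t - μ)) - μ) * s t := by
    rw [Finset.mul_sum, Finset.sum_filter]
    refine Finset.sum_le_sum fun t _ => ?_
    rw [← mul_assoc]
    split_ifs with h
    · have : μ + γ * (v t - μ) ≤ v t := by nlinarith
      rw [min_eq_right this]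
      exact le_of_eq (by ring)
    · have : γ * (v t - μ) ≤ 0 := mul_nonpos_of_nonneg_of_nonpos hγ0.le (by linarith)
      exact mul_nonpos_of_nonpos_of_nonneg this (hs t).le
  exact le_of_mul_le_mul_left (h3.trans (h1.trans h2)) hγ0
end

section
/- The 1559 mechanism is OCA-proof: fix a base fee r ≥ 0, marginal cost μ ≥ 0, capacity K > 0, and any γ ∈ (0,1]. The bidding strategy σ(v) = min{v, μ + r + γ(v − μ − r)} is individually rational for the 1559 mechanism (where an included transaction pays b_t − r per unit size to the miner and burns r per unit size, so its total charge is b_t), and for every finite set T of transactions with sizes s_t > 0 and valuations v_t ≥ 0, every feasible block B* ⊆ T maximizing Σ_{t∈B} (σ(v_t) − r − μ)·s_t over feasible blocks B ⊆ T also maximizes the joint utility Σ_{t∈B} (v_t − r − μ)·s_t over all feasible blocks B ⊆ T. Hence no off-chain agreement can make every transaction creator and the miner strictly better off than the on-chain outcome under bids σ(v). -/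
/-- The 1559 mechanism is OCA-proof.  For any `γ ∈ (0,1]`, the
bidding strategy `σ(w) = min w (μ + r + γ·(w - μ - r))` is individually rational
(the bid, which is the total charge in the 1559 mechanism, never exceeds the
valuation), and every feasible block `Bstar` maximizing `∑ (σ(v t) - r - μ) * s t`
over feasible blocks of `T` also maximizes the joint utility
`∑ (v t - r - μ) * s t` over all feasible blocks of `T`. -/
theorem mech1559_oca_proof
    {ι : Type*} (r μ K γ : ℝ) (hr : 0 ≤ r) (hμ : 0 ≤ μ) (hK : 0 < K)
    (hγ0 : 0 < γ) (hγ1 : γ ≤ 1) :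
    (∀ w : ℝ, 0 ≤ w → min w (μ + r + γ * (w - μ - r)) ≤ w) ∧
    (∀ (T : Finset ι) (s v : ι → ℝ), (∀ t, 0 < s t) → (∀ t, 0 ≤ v t) →
      ∀ Bstar ⊆ T, ∑ t ∈ Bstar, s t ≤ K →
        (∀ B ⊆ T, ∑ t ∈ B, s t ≤ K →
          ∑ t ∈ B, (min (v t) (μ + r + γ * (v t - μ - r)) - r - μ) * s t
            ≤ ∑ t ∈ Bstar, (min (v t) (μ + r + γ * (v t - μ - r)) - r - μ) * s t) →
        ∀ B ⊆ T, ∑ t ∈ B, s t ≤ K →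
          ∑ t ∈ B, (v t - r - μ) * s t ≤ ∑ t ∈ Bstar, (v t - r - μ) * s t) := by
  refine ⟨fun w _ => min_le_left _ _, ?_⟩
  intro T s v hs _ Bstar _ _ hmax B hB hBK
  have key := hmax (B.filter (fun t => 0 ≤ v t - r - μ))
    ((Finset.filter_subset _ _).trans hB)
    ((Finset.sum_le_sum_of_subset_of_nonneg (Finset.filter_subset _ _)
      (fun t _ _ => (hs t).le)).trans hBK)
  have h1 : ∑ t ∈ Bstar, (min (v t) (μ + r + γ * (v t - μ - r)) - r - μ) * s t
      ≤ γ * ∑ t ∈ Bstar, (v t - r - μ) * s t := by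
    rw [Finset.mul_sum]
    refine Finset.sum_le_sum fun t _ => ?_
    rw [← mul_assoc]
    refine mul_le_mul_of_nonneg_right ?_ (hs t).le
    have := min_le_right (v t) (μ + r + γ * (v t - μ - r))
    linarith
  have h2 : γ * ∑ t ∈ B, (v t - r - μ) * s t
      ≤ ∑ t ∈ B.filter (fun t => 0 ≤ v t - r - μ),
        (min (v t) (μ + r + γ * (v t - μ - r)) - r - μ) * s t := by
    rw [Finset.mul_sum, Finset.sum_filter]
    refine Finset.sum_le_sum fun t _ => ?_
    split_ifs with h
    · rw [← mul_assoc]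
      refine mul_le_mul_of_nonneg_right ?_ (hs t).le
      rw [min_eq_right (by nlinarith)]
      linarith
    · have h' : v t - r - μ ≤ 0 := (not_le.mp h).le
      exact mul_nonpos_of_nonneg_of_nonpos hγ0.le
        (mul_nonpos_of_nonpos_of_nonneg h' (hs t).le)
  exact le_of_mul_le_mul_left (h2.trans (key.trans h1)) hγ0
end

section
/- The tipless mechanism with hard-coded tip δ equal to the marginal cost μ is OCA-proof whenever the base fee is not excessively low. Fix a base fee r ≥ 0, marginal cost μ ≥ 0, tip δ = μ, maximum block size 2C, and a finite set T of transactions with sizes s_t > 0 and valuations v_t ≥ 0 such that Σ_{t : v_t ≥ r+μ} s_t ≤ 2C. The bidding strategy σ(v) = min{r + δ, v} is individually rational, under bids σ(v) the set of eligible transactions (those with bid ≥ r + δ) is exactly {t : v_t ≥ r + μ}, this set is feasible and is the block produced by the tipless allocation rule, and it maximizes the joint utility Σ_{t∈B} (v_t − r − μ)·s_t over all feasible blocks B ⊆ T. Hence no off-chain agreement can make every transaction creator and the miner strictly better off than this on-chain outcome. -/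
/-- The tipless mechanism with hard-coded tip `δ = μ` is OCA-proof
whenever the base fee is not excessively low (`∑_{t : v t ≥ r+μ} s t ≤ 2C`).
The bidding strategy `σ(w) = min (r + δ) w` is individually rational (an eligible
bid implies the total charge `r + δ` is at most the valuation); under bids `σ ∘ v`
the eligible set (bid at least `r + δ`) is exactly `{t ∈ T : r + μ ≤ v t}`; this set
is feasible and has the largest total size among feasible subsets of eligible
transactions (so it is the block produced by the tipless allocation rule); and it
maximizes the joint utility `∑ (v t - r - μ) * s t` over all feasible blocks of `T`. -/
theorem tipless_oca_proof_not_excessively_low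
    {ι : Type*} [DecidableEq ι]
    (r μ δ C : ℝ) (hr : 0 ≤ r) (hμ : 0 ≤ μ) (hδ : δ = μ) (hC : 0 < C)
    (T : Finset ι) (s v : ι → ℝ) (hs : ∀ t, 0 < s t) (hv : ∀ t, 0 ≤ v t)
    (hnotlow : ∑ t ∈ T.filter (fun t => r + μ ≤ v t), s t ≤ 2 * C) :
    -- individual rationality of σ(w) = min (r + δ) w
    (∀ w : ℝ, 0 ≤ w → r + δ ≤ min (r + δ) w → r + δ ≤ w) ∧
    -- under bids σ ∘ v the eligible transactions are exactly those with v t ≥ r + μ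
    (T.filter (fun t => r + δ ≤ min (r + δ) (v t))
      = T.filter (fun t => r + μ ≤ v t)) ∧
    -- that set is feasible
    (∑ t ∈ T.filter (fun t => r + μ ≤ v t), s t ≤ 2 * C) ∧
    -- it is a largest-possible feasible subset of the eligible transactions,
    -- hence the block produced by the tipless allocation rule
    (∀ B ⊆ T.filter (fun t => r + μ ≤ v t), ∑ t ∈ B, s t ≤ 2 * C →
      ∑ t ∈ B, s t ≤ ∑ t ∈ T.filter (fun t => r + μ ≤ v t), s t) ∧
    -- and it maximizes the joint utility over all feasible blocks of T
    (∀ B ⊆ T, ∑ t ∈ B, s t ≤ 2 * C →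
      ∑ t ∈ B, (v t - r - μ) * s t
        ≤ ∑ t ∈ T.filter (fun t => r + μ ≤ v t), (v t - r - μ) * s t) := by
  subst hδ
  refine ⟨fun w _ h => (le_min_iff.mp h).2, ?_, hnotlow, ?_, ?_⟩
  · ext t
    simp
  · intro B hB _
    exact Finset.sum_le_sum_of_subset_of_nonneg hB (fun t _ _ => (hs t).le)
  · intro B hB _
    calc ∑ t ∈ B, (v t - r - δ) * s t
        ≤ ∑ t ∈ B.filter (fun t => r + δ ≤ v t), (v t - r - δ) * s t := by
          rw [Finset.sum_filter]
          refine Finset.sum_le_sum (fun t _ => ?_)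
          split_ifs with h
          · exact le_rfl
          · exact mul_nonpos_of_nonpos_of_nonneg (by linarith) (hs t).le
      _ ≤ _ := by
          refine Finset.sum_le_sum_of_subset_of_nonneg (Finset.filter_subset_filter _ hB) ?_
          intro t ht _
          have := (Finset.mem_filter.mp ht).2
          exact mul_nonneg (by linarith) (hs t).le
end

section
/- The tipless mechanism is not OCA-proof in general when the base fee is excessively low. Fix a base fee r ≥ 0, marginal cost μ ≥ 0, tip δ = μ, maximum block size 2C with C > 1, and the tipless allocation rule that includes a feasible subset of eligible transactions (bid ≥ r + δ) of maximum total size, with ties broken by a fixed rule independent of bids and valuations. Then for every individually rational bidding strategy σ, there exists a finite set T of transactions with sizes s_t > 0 and valuations v_t for which the base fee is excessively low (Σ_{t : v_t ≥ r+μ} s_t > 2C) and the joint utility Σ_{t∈B} (v_t − r − μ)·s_t of the block B produced by the tipless mechanism under bids σ(v) is strictly smaller than the joint utility of some other feasible block of T. -/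
/-- The tipless mechanism (with tip `δ = μ`) is not OCA-proof in
general when the base fee is excessively low.  Here `x T s b` is the block mined
on mempool `T` with sizes `s` and bids `b`: it consists of eligible transactions
(bid at least `r + δ`), is feasible (total size at most `2C`), has maximum total
size among feasible subsets of eligible transactions, and depends on the bids only
through the eligible set (fixed tie-breaking, independent of bids and valuations).
Then for every individually rational bidding strategy `σ` there are a mempool `T`,
sizes `s` and valuations `v` for which the base fee is excessively low
(`∑_{t : v t ≥ r+μ} s t > 2C`) and the joint utility of the block produced under
bids `σ ∘ v` is strictly smaller than that of some other feasible block of `T`. -/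
theorem tipless_not_oca_proof_excessively_low
    (r μ δ C : ℝ) (hr : 0 ≤ r) (hμ : 0 ≤ μ) (hδ : δ = μ) (hC : 1 < C)
    (x : Finset ℕ → (ℕ → ℝ) → (ℕ → ℝ) → Finset ℕ)
    (hx_elig : ∀ T s b, x T s b ⊆ T.filter (fun t => r + δ ≤ b t))
    (hx_feas : ∀ T s b, (∀ t, 0 < s t) → ∑ t ∈ x T s b, s t ≤ 2 * C)
    (hx_max : ∀ T s b, (∀ t, 0 < s t) →
      ∀ B ⊆ T.filter (fun t => r + δ ≤ b t), ∑ t ∈ B, s t ≤ 2 * C →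
        ∑ t ∈ B, s t ≤ ∑ t ∈ x T s b, s t)
    (hx_tie : ∀ T s b b',
      T.filter (fun t => r + δ ≤ b t) = T.filter (fun t => r + δ ≤ b' t) →
      x T s b = x T s b')
    (σ : ℝ → ℝ) (hσ0 : ∀ w, 0 ≤ w → 0 ≤ σ w)
    (hIR : ∀ (T : Finset ℕ) (s v : ℕ → ℝ), (∀ t, 0 < s t) → (∀ t, 0 ≤ v t) →
      ∀ t ∈ x T s (σ ∘ v), r + δ ≤ v t) :
    ∃ (T : Finset ℕ) (s v : ℕ → ℝ), (∀ t, 0 < s t) ∧ (∀ t, 0 ≤ v t) ∧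
      2 * C < ∑ t ∈ T.filter (fun t => r + μ ≤ v t), s t ∧
      ∃ B' ⊆ T, ∑ t ∈ B', s t ≤ 2 * C ∧
        ∑ t ∈ x T s (σ ∘ v), (v t - r - μ) * s t
          < ∑ t ∈ B', (v t - r - μ) * s t := by
  subst hδ
  by_cases h : r + δ ≤ σ (r + δ + 1)
  · let s : ℕ → ℝ := fun t => if t = 0 then 2 * C else 1
    let v : ℕ → ℝ := fun t => if t = 0 then r + δ + 1 else r + δ + 2 * C + 1
    have s0 : s 0 = 2 * C := by simp [s]
    have s1 : s 1 = 1 := by simp [s]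
    have v0 : v 0 = r + δ + 1 := by simp [v]
    have v1 : v 1 = r + δ + 2 * C + 1 := by simp [v]
    have hs : ∀ t, 0 < s t := by
      intro t
      by_cases ht : t = 0 <;> simp [s, ht]
      linarith
    have hv : ∀ t, 0 ≤ v t := by
      intro t
      by_cases ht : t = 0 <;> simp [v, ht] <;> linarith
    have hf : ({0, 1} : Finset ℕ).filter (fun t => r + δ ≤ v t) = {0, 1} := by
      apply Finset.filter_true_of_mem
      intro t ht
      simp only [Finset.mem_insert, Finset.mem_singleton] at ht
      rcases ht with rfl | rfl
      · rw [v0]; linarith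
      · rw [v1]; linarith
    refine ⟨{0, 1}, s, v, hs, hv, ?_, {1}, by simp, ?_, ?_⟩
    · rw [hf, Finset.sum_pair (by norm_num), s0, s1]; linarith
    · rw [Finset.sum_singleton, s1]; linarith
    · have hsub : x {0, 1} s (σ ∘ v) ⊆ {0, 1} :=
        (hx_elig _ _ _).trans (Finset.filter_subset _ _)
      have hge := hx_max {0, 1} s (σ ∘ v) hs {0} (by
        intro t ht
        simp only [Finset.mem_singleton] at ht
        subst ht
        simp only [Finset.mem_filter, Function.comp, v0]
        exact ⟨by simp, h⟩) (by simp [s0])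
      rw [Finset.sum_singleton, s0] at hge
      have hle := hx_feas {0, 1} s (σ ∘ v) hs
      generalize x {0, 1} s (σ ∘ v) = X at *
      have h0 : 0 ∈ X := by
        by_contra h0
        have hX : X ⊆ {1} := by
          intro t ht
          have := hsub ht
          simp only [Finset.mem_insert, Finset.mem_singleton] at this ⊢
          rcases this with rfl | rfl
          · exact absurd ht h0
          · rfl
        have := Finset.sum_le_sum_of_subset_of_nonneg hX (f := s) (fun i _ _ => (hs i).le)
        rw [Finset.sum_singleton, s1] at this
        linarith
      have h1 : 1 ∉ X := by
        intro h1
        have hX : ({0, 1} : Finset ℕ) ⊆ X := by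
          intro t ht
          simp only [Finset.mem_insert, Finset.mem_singleton] at ht
          rcases ht with rfl | rfl <;> assumption
        have := Finset.sum_le_sum_of_subset_of_nonneg hX (f := s) (fun i _ _ => (hs i).le)
        rw [Finset.sum_pair (by norm_num), s0, s1] at this
        linarith
      have hX : X = {0} := by
        ext t
        constructor
        · intro ht
          have := hsub ht
          simp only [Finset.mem_insert, Finset.mem_singleton] at this ⊢
          rcases this with rfl | rfl
          · rfl
          · exact absurd ht h1
        · intro ht
          simp only [Finset.mem_singleton] at ht
          subst ht
          exact h0
      rw [hX, Finset.sum_singleton, Finset.sum_singleton, s0, s1, v0, v1]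
      linarith
  · have hE : x {0, 1} (fun _ => 2 * C) (σ ∘ fun _ => r + δ + 1) = ∅ := by
      apply Finset.subset_empty.mp
      refine (hx_elig _ _ _).trans ?_
      simp [Function.comp, h]
    refine ⟨{0, 1}, fun _ => 2 * C, fun _ => r + δ + 1, fun _ => by linarith,
      fun _ => by linarith, ?_, {0}, by simp, by simp, ?_⟩
    · rw [Finset.filter_true_of_mem (fun _ _ => by linarith), Finset.sum_pair (by norm_num)]
      linarith
    · rw [hE, Finset.sum_empty, Finset.sum_singleton]
      linarith
end
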